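/- There exists an absolute constant C > 0 such that for every sequence (s_j) of real numbers and all natural numbers m, n ≥ 1, the discrepancy D(m) := sup over 0 ≤ a ≤ b ≤ 1 of | (1/m)·#{1 ≤ j ≤ m : a ≤ (s_j mod 1) ≤ b} − (b − a) | satisfies D(m) ≤ C · ( 1/n + (1/m) Σ_{k=1}^{n} (1/k) | Σ_{j=1}^{m} e^{2πi k s_j} | ). -/

import Mathlib

open Finset

theorem integral_exp_two_pi_int (d : ℤ) :
    ∫ t in (-(1 / 2) : ℝ)..(1 / 2), Complex.exp (2 * Real.pi * Complex.I * d * t) =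
      if d = 0 then 1 else 0 := by
  split_ifs with h
  · subst h; norm_num
  · have hw : (2 * Real.pi * Complex.I * d : ℂ) ≠ 0 := by
      simp [Real.pi_ne_zero, h]
    rw [integral_exp_mul_complex hw, div_eq_zero_iff, sub_eq_zero]
    left
    rw [Complex.exp_eq_exp_iff_exists_int]
    exact ⟨d, by push_cast; ring⟩

/-- The sawtooth `1/2 - fract x` has Fourier coefficients of norm `1 / (2π|d|)`. -/
theorem integral_sawtooth_mul_exp (d : ℤ) :
    ∫ u in (0 : ℝ)..1, ((1 / 2 - Int.fract u : ℝ) : ℂ) *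
        Complex.exp (2 * Real.pi * Complex.I * d * u) =
      -(2 * Real.pi * Complex.I * d)⁻¹ := by
  have hcongr : ∫ u in (0 : ℝ)..1, ((1 / 2 - Int.fract u : ℝ) : ℂ) *
        Complex.exp (2 * Real.pi * Complex.I * d * u) =
      ∫ u in (0 : ℝ)..1, (1 / 2 - (u : ℂ)) * Complex.exp (2 * Real.pi * Complex.I * d * u) := by
    rw [intervalIntegral.integral_of_le zero_le_one, intervalIntegral.integral_of_le zero_le_one,
      MeasureTheory.integral_Ioc_eq_integral_Ioo, MeasureTheory.integral_Ioc_eq_integral_Ioo]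
    refine MeasureTheory.setIntegral_congr_fun measurableSet_Ioo fun u hu => ?_
    simp only [Int.fract_eq_self.2 ⟨hu.1.le, hu.2⟩]
    push_cast; rfl
  rw [hcongr]
  rcases eq_or_ne d 0 with rfl | h
  · have hd : ∀ u ∈ Set.uIcc (0 : ℝ) 1,
        HasDerivAt (fun u : ℝ => (u : ℂ) / 2 - (u : ℂ) ^ 2 / 2) (1 / 2 - (u : ℂ)) u := by
      intro u _
      have h1 := (hasDerivAt_id u).ofReal_comp
      have := (h1.div_const 2).sub ((h1.pow 2).div_const 2)
      refine this.congr_deriv ?_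
      simp
    have := intervalIntegral.integral_eq_sub_of_hasDerivAt hd
      (Continuous.intervalIntegrable (by fun_prop) _ _)
    simp at this ⊢
    simpa using this
  · set w : ℂ := 2 * Real.pi * Complex.I * d with hwdef
    have hw : w ≠ 0 := by simp [hwdef, Real.pi_ne_zero, h]
    have hd : ∀ u ∈ Set.uIcc (0 : ℝ) 1,
        HasDerivAt (fun u : ℝ => ((1 / 2 - (u : ℂ)) / w + 1 / w ^ 2) * Complex.exp (w * u))
          ((1 / 2 - (u : ℂ)) * Complex.exp (w * u)) u := by
      intro u _
      have h1 := (hasDerivAt_id u).ofReal_comp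
      have h2 := ((h1.const_sub (1 / 2)).div_const w).add_const (1 / w ^ 2)
      have h3 := (h1.const_mul w).cexp
      refine (h2.mul h3).congr_deriv ?_
      simp
      field_simp
      ring
    rw [intervalIntegral.integral_eq_sub_of_hasDerivAt hd
      (Continuous.intervalIntegrable (by fun_prop) _ _)]
    have he : Complex.exp w = 1 := by
      rw [Complex.exp_eq_one_iff]
      exact ⟨d, by rw [hwdef]; ring⟩
    simp [he]
    field_simp
    ring

theorem intervalIntegrable_sawtooth (y a b : ℝ) :
    IntervalIntegrable (fun t => 1 / 2 - Int.fract (y + t)) MeasureTheory.volume a b := by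
  refine (intervalIntegrable_const (c := (1 : ℝ))).mono_fun
    (Measurable.aestronglyMeasurable (by fun_prop)) (Filter.Eventually.of_forall fun t => ?_)
  have h1 := Int.fract_nonneg (y + t)
  have h2 := Int.fract_lt_one (y + t)
  simp only [Real.norm_eq_abs, abs_one, abs_le]
  constructor <;> linarith

theorem integral_shift_sawtooth_mul_exp (d : ℤ) (y : ℝ) :
    ∫ t in (-(1 / 2) : ℝ)..(1 / 2), ((1 / 2 - Int.fract (y + t) : ℝ) : ℂ) *
        Complex.exp (2 * Real.pi * Complex.I * d * t) =
      -(2 * Real.pi * Complex.I * d)⁻¹ * Complex.exp (-(2 * Real.pi * Complex.I * d * y)) := by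
  have hper : Function.Periodic (fun u : ℝ => ((1 / 2 - Int.fract u : ℝ) : ℂ) *
        Complex.exp (2 * Real.pi * Complex.I * d * u)) 1 := by
    intro u
    simp only [Int.fract_add_one]
    congr 1
    rw [Complex.exp_eq_exp_iff_exists_int]
    exact ⟨d, by push_cast; ring⟩
  have h1 : ∀ t : ℝ, ((1 / 2 - Int.fract (y + t) : ℝ) : ℂ) *
        Complex.exp (2 * Real.pi * Complex.I * d * t) =
      (fun u : ℝ => ((1 / 2 - Int.fract u : ℝ) : ℂ) *
        Complex.exp (2 * Real.pi * Complex.I * d * u)) (y + t) *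
        Complex.exp (-(2 * Real.pi * Complex.I * d * y)) := by
    intro t
    simp only
    rw [mul_assoc _ (Complex.exp _) (Complex.exp _), ← Complex.exp_add]
    congr 2
    push_cast; ring
  simp_rw [h1]
  rw [intervalIntegral.integral_mul_const, intervalIntegral.integral_comp_add_left
    (fun u : ℝ => ((1 / 2 - Int.fract u : ℝ) : ℂ) *
        Complex.exp (2 * Real.pi * Complex.I * d * u))]
  have := hper.intervalIntegral_add_eq (y + -(1 / 2)) 0
  rw [show y + -(1 / 2) + 1 = y + 1 / 2 by ring, zero_add, integral_sawtooth_mul_exp] at this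
  rw [this]

theorem sum_range_natAbs_sub_le (f : ℕ → ℝ) (hf : ∀ i, 0 ≤ f i) (N k : ℕ) (hk : k < N) :
    ∑ l ∈ range N, f ((k : ℤ) - l).natAbs ≤ 2 * ∑ d ∈ range N, f d := by
  rw [← sum_filter_add_sum_filter_not (range N) (fun l => l ≤ k), two_mul]
  have key : ∀ t ⊆ range N, Set.InjOn (fun l : ℕ => ((k : ℤ) - l).natAbs) t →
      ∑ l ∈ t, f ((k : ℤ) - l).natAbs ≤ ∑ d ∈ range N, f d := by
    intro t ht hinj
    rw [← sum_image (f := f) hinj]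
    refine sum_le_sum_of_subset_of_nonneg (fun x hx => ?_) fun i _ _ => hf i
    obtain ⟨l, hl, rfl⟩ := mem_image.1 hx
    have := mem_range.1 (ht hl)
    rw [mem_range]
    omega
  refine add_le_add (key _ (filter_subset _ _) ?_) (key _ (filter_subset _ _) ?_) <;>
  · intro x hx y hy hxy
    simp only [coe_filter, Set.mem_ofPred_eq] at hx hy hxy
    omega

/-- The Fejér kernel `∑_{|d| < n} (1 - |d|/n) e(dt)`. -/
noncomputable def fejerKernel (n : ℕ) (t : ℝ) : ℝ :=
  ‖∑ k ∈ range n, Complex.exp (2 * Real.pi * Complex.I * k * t)‖ ^ 2 / n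

theorem fejerKernel_nonneg (n : ℕ) (t : ℝ) : 0 ≤ fejerKernel n t := by
  unfold fejerKernel; positivity

theorem continuous_fejerKernel (n : ℕ) : Continuous (fejerKernel n) := by
  unfold fejerKernel; fun_prop

theorem ofReal_fejerKernel (n : ℕ) (t : ℝ) :
    (fejerKernel n t : ℂ) = (∑ k ∈ range n, ∑ l ∈ range n,
      Complex.exp (2 * Real.pi * Complex.I * ((k : ℤ) - (l : ℤ) : ℤ) * t)) / n := by
  unfold fejerKernel
  push_cast
  rw [← Complex.mul_conj', map_sum, sum_mul_sum]
  congr 1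
  refine sum_congr rfl fun k _ => sum_congr rfl fun l _ => ?_
  rw [← Complex.exp_conj, ← Complex.exp_add]
  congr 1
  simp only [map_mul, Complex.conj_ofNat, Complex.conj_ofReal, Complex.conj_I,
    Complex.conj_natCast]
  ring

theorem fejerKernel_le (n : ℕ) (t : ℝ) (ht : |t| ≤ 1 / 2) (h0 : t ≠ 0) :
    fejerKernel n t ≤ 1 / (4 * n * t ^ 2) := by
  have hgeom : ‖∑ k ∈ range n, Complex.exp (2 * Real.pi * Complex.I * k * t)‖ ≤ 1 / (2 * |t|) := by
    have hs : ∑ k ∈ range n, Complex.exp (2 * Real.pi * Complex.I * k * t) =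
        ∑ k ∈ range n, Complex.exp (Complex.I * (2 * Real.pi * t : ℝ)) ^ k := by
      refine sum_congr rfl fun k _ => ?_
      rw [← Complex.exp_nat_mul]
      congr 1; push_cast; ring
    have hm := congrArg norm (geom_sum_mul (Complex.exp (Complex.I * (2 * Real.pi * t : ℝ))) n)
    rw [norm_mul, Complex.norm_exp_I_mul_ofReal_sub_one, ← hs] at hm
    have hsin : 2 * |t| ≤ |Real.sin (Real.pi * t)| := by
      have h := Real.mul_abs_le_abs_sin (x := Real.pi * t) (by
        rw [abs_mul, abs_of_pos Real.pi_pos]; nlinarith [Real.pi_pos])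
      rw [abs_mul, abs_of_pos Real.pi_pos] at h
      have := Real.pi_pos
      field_simp at h
      linarith
    have h2 : ‖Complex.exp (Complex.I * (2 * Real.pi * t : ℝ)) ^ n - 1‖ ≤ 2 := by
      refine (norm_sub_le _ _).trans ?_
      rw [norm_pow, mul_comm, Complex.norm_exp_ofReal_mul_I]
      norm_num
    rw [show 2 * Real.pi * t / 2 = Real.pi * t by ring, Real.norm_eq_abs, abs_mul, abs_two] at hm
    have hpos : 0 < |t| := abs_pos.2 h0
    rw [le_div_iff₀ (by positivity)]
    have hn := norm_nonneg (∑ k ∈ range n, Complex.exp (2 * Real.pi * Complex.I * k * t))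
    nlinarith
  unfold fejerKernel
  have : ‖∑ k ∈ range n, Complex.exp (2 * Real.pi * Complex.I * k * t)‖ ^ 2 ≤
      (1 / (2 * |t|)) ^ 2 := by gcongr
  calc _ ≤ (1 / (2 * |t|)) ^ 2 / n := by gcongr
    _ = _ := by rw [div_pow, mul_pow, sq_abs]; ring

/-- Pairing with the Fejér kernel is controlled by bounds on Fourier coefficients. -/
theorem integral_mul_fejerKernel (n : ℕ) (G : ℝ → ℝ)
    (hG : IntervalIntegrable G MeasureTheory.volume (-(1 / 2)) (1 / 2)) :
    ((∫ t in (-(1 / 2) : ℝ)..(1 / 2), G t * fejerKernel n t : ℝ) : ℂ) =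
      (∑ k ∈ range n, ∑ l ∈ range n, ∫ t in (-(1 / 2) : ℝ)..(1 / 2),
        (G t : ℂ) * Complex.exp (2 * Real.pi * Complex.I * ((k : ℤ) - (l : ℤ) : ℤ) * t)) / n := by
  have hint : ∀ d : ℤ, IntervalIntegrable
      (fun t : ℝ => (G t : ℂ) * Complex.exp (2 * Real.pi * Complex.I * d * t))
      MeasureTheory.volume (-(1 / 2)) (1 / 2) := fun d =>
    IntervalIntegrable.mul_continuousOn (f := fun t => (G t : ℂ))
      (by exact ⟨hG.1.ofReal, hG.2.ofReal⟩)
      (Continuous.continuousOn (by fun_prop))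
  rw [← intervalIntegral.integral_ofReal]
  simp_rw [Complex.ofReal_mul, ofReal_fejerKernel, mul_div_assoc', mul_sum]
  rw [intervalIntegral.integral_div, intervalIntegral.integral_finsetSum]
  · congr 1
    refine sum_congr rfl fun k _ => ?_
    rw [intervalIntegral.integral_finsetSum]
    exact fun l _ => hint _
  · intro k _
    have := IntervalIntegrable.sum (range n) (fun l _ => hint ((k : ℤ) - (l : ℤ)))
    refine (congrArg (IntervalIntegrable · MeasureTheory.volume _ _) ?_).mp this
    funext t
    simp

theorem integral_fejerKernel (n : ℕ) (hn : 1 ≤ n) :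
    ∫ t in (-(1 / 2) : ℝ)..(1 / 2), fejerKernel n t = 1 := by
  have h := integral_mul_fejerKernel n (fun _ => 1) (intervalIntegrable_const)
  simp only [one_mul, Complex.ofReal_one, integral_exp_two_pi_int, sub_eq_zero, Nat.cast_inj,
    sum_ite_eq, mem_range] at h
  rw [sum_congr rfl (g := fun _ => (1 : ℂ)) fun k hk => if_pos (mem_range.1 hk)] at h
  have : (n : ℂ) ≠ 0 := by simp; omega
  rw [sum_const, card_range, nsmul_eq_mul, mul_one, div_self this] at h
  exact_mod_cast h

theorem abs_integral_mul_fejerKernel_le (n : ℕ) (hn : 1 ≤ n) (G : ℝ → ℝ)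
    (hG : IntervalIntegrable G MeasureTheory.volume (-(1 / 2)) (1 / 2))
    (A : ℕ → ℝ) (hA : ∀ d : ℤ, ‖∫ t in (-(1 / 2) : ℝ)..(1 / 2),
        (G t : ℂ) * Complex.exp (2 * Real.pi * Complex.I * d * t)‖ ≤ A d.natAbs) :
    |∫ t in (-(1 / 2) : ℝ)..(1 / 2), G t * fejerKernel n t| ≤ 2 * ∑ d ∈ range n, A d := by
  have hA0 : ∀ i, 0 ≤ A i := fun i => (norm_nonneg _).trans (by simpa using hA i)
  have hn' : (0 : ℝ) < n := by exact_mod_cast hn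
  rw [← Real.norm_eq_abs, ← Complex.norm_real, integral_mul_fejerKernel n G hG, norm_div,
    Complex.norm_natCast, div_le_iff₀ hn']
  calc _ ≤ ∑ k ∈ range n, ∑ l ∈ range n, A ((k : ℤ) - l).natAbs :=
        norm_sum_le_of_le _ fun k _ => norm_sum_le_of_le _ fun l _ => hA _
    _ ≤ ∑ k ∈ range n, 2 * ∑ d ∈ range n, A d :=
        sum_le_sum fun k hk => sum_range_natAbs_sub_le A hA0 n k (mem_range.1 hk)
    _ = _ := by simp; ring

theorem integral_inv_sq_add_sq_le (h : ℝ) (hh : 0 < h) (a b : ℝ) :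
    ∫ t in a..b, 1 / (t ^ 2 + h ^ 2) ≤ Real.pi / h := by
  have hd : ∀ t ∈ Set.uIcc a b,
      HasDerivAt (fun t => Real.arctan (t / h) / h) (1 / (t ^ 2 + h ^ 2)) t := by
    intro t _
    refine ((((hasDerivAt_id t).div_const h).arctan).div_const h).congr_deriv ?_
    simp only [id]
    field_simp
    ring
  rw [intervalIntegral.integral_eq_sub_of_hasDerivAt hd
    (Continuous.intervalIntegrable (by
      refine continuous_const.div (by fun_prop) fun t => by positivity) _ _), ← sub_div]
  gcongr
  linarith [Real.arctan_lt_pi_div_two (b / h), Real.neg_pi_div_two_lt_arctan (a / h)]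

/-- A function bounded below by `-M` which is at least `M / 4` on a window of radius `M / 4` has a
large average against the Fejér kernel. -/
theorem le_integral_mul_fejerKernel (n : ℕ) (hn : 1 ≤ n) (G : ℝ → ℝ) (M : ℝ) (hM : 0 < M)
    (hG : IntervalIntegrable G MeasureTheory.volume (-(1 / 2)) (1 / 2))
    (hlow : ∀ t, -M ≤ G t) (hwin : ∀ t, |t| ≤ M / 4 → M / 4 ≤ G t) :
    M / 4 - 5 / 2 * Real.pi / n ≤ ∫ t in (-(1 / 2) : ℝ)..(1 / 2), G t * fejerKernel n t := by
  have hn' : (0 : ℝ) < n := by exact_mod_cast hn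
  have hcont : Continuous fun t : ℝ => 5 * M / (8 * n) * (1 / (t ^ 2 + (M / 4) ^ 2)) :=
    continuous_const.mul (continuous_const.div (by fun_prop) fun t => by positivity)
  have hc := continuous_fejerKernel n
  have hpt : ∀ t ∈ Set.Icc (-(1 / 2) : ℝ) (1 / 2),
      M / 4 * fejerKernel n t - 5 * M / (8 * n) * (1 / (t ^ 2 + (M / 4) ^ 2)) ≤
        G t * fejerKernel n t := by
    intro t ht
    have hF := fejerKernel_nonneg n t
    by_cases hth : |t| ≤ M / 4
    · have h1 := mul_le_mul_of_nonneg_right (hwin t hth) hF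
      have : 0 ≤ 5 * M / (8 * n) * (1 / (t ^ 2 + (M / 4) ^ 2)) := by positivity
      linarith
    · push Not at hth
      have h0 : t ≠ 0 := by
        rintro rfl
        rw [abs_zero] at hth
        linarith
      have h1 := mul_le_mul_of_nonneg_right (hlow t) hF
      have h2 := fejerKernel_le n t (abs_le.2 ht) h0
      have h3 : 1 / (4 * n * t ^ 2) ≤ 1 / (2 * n) * (1 / (t ^ 2 + (M / 4) ^ 2)) := by
        rw [one_div_mul_one_div]
        have : (M / 4) ^ 2 ≤ t ^ 2 := by
          rw [← sq_abs t]; gcongr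
        apply one_div_le_one_div_of_le (by positivity)
        nlinarith
      have h4 := mul_le_mul_of_nonneg_left (h2.trans h3) (by positivity : 0 ≤ 5 / 4 * M)
      have h5 : 5 / 4 * M * (1 / (2 * n) * (1 / (t ^ 2 + (M / 4) ^ 2))) =
        5 * M / (8 * n) * (1 / (t ^ 2 + (M / 4) ^ 2)) := by ring
      linarith
  have hmono := intervalIntegral.integral_mono_on (by norm_num)
    (((hc.const_mul (M / 4)).sub hcont).intervalIntegrable _ _)
    (hG.mul_continuousOn hc.continuousOn) hpt
  refine le_trans ?_ hmono
  simp only [Pi.sub_apply]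
  rw [intervalIntegral.integral_sub ((hc.const_mul (M / 4)).intervalIntegrable _ _)
    (hcont.intervalIntegrable _ _), intervalIntegral.integral_const_mul,
    intervalIntegral.integral_const_mul, integral_fejerKernel n hn, mul_one]
  have h1 := mul_le_mul_of_nonneg_left
    (integral_inv_sq_add_sq_le (M / 4) (by positivity) (-(1 / 2)) (1 / 2))
    (by positivity : 0 ≤ 5 * M / (8 * n))
  have h2 : 5 * M / (8 * n) * (Real.pi / (M / 4)) = 5 / 2 * Real.pi / n := by
    field_simp; ring
  linarith

/-- The empirical sawtooth: its increments are the discrepancies of the points `s j` on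
intervals modulo one. -/
noncomputable def empiricalSawtooth (s : ℕ → ℝ) (m : ℕ) (x : ℝ) : ℝ :=
  (∑ j ∈ Icc 1 m, (1 / 2 - Int.fract (x - s j))) / m

theorem empiricalSawtooth_sub_le (s : ℕ → ℝ) (m : ℕ) (hm : 1 ≤ m) (x t : ℝ) (ht : 0 ≤ t) :
    empiricalSawtooth s m x - t ≤ empiricalSawtooth s m (x + t) := by
  have hm' : (0 : ℝ) < m := by exact_mod_cast hm
  unfold empiricalSawtooth
  rw [sub_le_iff_le_add, div_add' _ _ _ hm'.ne', div_le_div_iff_of_pos_right hm']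
  have : t * m = ∑ j ∈ Icc 1 m, t := by simp [mul_comm]
  rw [this, ← sum_add_distrib]
  refine sum_le_sum fun j _ => ?_
  have h1 : Int.fract (x + t - s j) ≤ Int.fract (x - s j) + t := by
    have h2 : ⌊x - s j⌋ ≤ ⌊x + t - s j⌋ := Int.floor_le_floor (by linarith)
    have h3 : ((⌊x - s j⌋ : ℤ) : ℝ) ≤ ⌊x + t - s j⌋ := by exact_mod_cast h2
    unfold Int.fract
    linarith
  linarith

theorem abs_empiricalSawtooth_le (s : ℕ → ℝ) (m : ℕ) (hm : 1 ≤ m) (x : ℝ) :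
    |empiricalSawtooth s m x| ≤ 1 := by
  have hm' : (0 : ℝ) < m := by exact_mod_cast hm
  unfold empiricalSawtooth
  rw [abs_div, abs_of_pos hm', div_le_iff₀ hm']
  calc _ ≤ ∑ j ∈ Icc 1 m, (1 : ℝ) := by
        refine (abs_sum_le_sum_abs _ _).trans (sum_le_sum fun j _ => ?_)
        have h1 := Int.fract_nonneg (x - s j)
        have h2 := Int.fract_lt_one (x - s j)
        rw [abs_le]
        constructor <;> linarith
    _ = _ := by simp

theorem norm_sum_exp_natAbs (s : ℕ → ℝ) (m : ℕ) (d : ℤ) :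
    ‖∑ j ∈ Icc 1 m, Complex.exp (2 * Real.pi * Complex.I * d * s j)‖ =
      ‖∑ j ∈ Icc 1 m, Complex.exp (2 * Real.pi * Complex.I * d.natAbs * s j)‖ := by
  rcases Int.natAbs_eq d with h | h
  · rw [← Int.cast_natCast d.natAbs, ← h]
  · have hd : (d : ℂ) = -(d.natAbs : ℂ) := by rw [← Int.cast_natCast, ← Int.cast_neg, ← h]
    rw [hd, ← Complex.norm_conj, map_sum]
    congr 1
    refine sum_congr rfl fun j _ => ?_
    rw [← Complex.exp_conj]
    congr 1
    simp only [map_mul, map_neg, Complex.conj_ofNat, Complex.conj_ofReal, Complex.conj_I,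
      Complex.conj_natCast]
    ring

theorem intervalIntegrable_empiricalSawtooth (s : ℕ → ℝ) (m : ℕ) (c a b : ℝ) :
    IntervalIntegrable (fun t => empiricalSawtooth s m (c + t)) MeasureTheory.volume a b := by
  have := (IntervalIntegrable.sum (Icc 1 m)
    (fun j _ => intervalIntegrable_sawtooth (c - s j) a b)).div_const (m : ℝ)
  refine (congrArg (IntervalIntegrable · MeasureTheory.volume _ _) ?_).mp this
  funext t
  simp only [empiricalSawtooth, Finset.sum_apply]
  congr 1
  refine sum_congr rfl fun j _ => ?_
  ring_nf

theorem norm_integral_empiricalSawtooth_mul_exp_le (s : ℕ → ℝ) (m : ℕ) (c : ℝ) (d : ℤ) :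
    ‖∫ t in (-(1 / 2) : ℝ)..(1 / 2), (empiricalSawtooth s m (c + t) : ℂ) *
        Complex.exp (2 * Real.pi * Complex.I * d * t)‖ ≤
      1 / m * (1 / (d.natAbs : ℝ) *
        ‖∑ j ∈ Icc 1 m, Complex.exp (2 * Real.pi * Complex.I * d.natAbs * s j)‖) := by
  have hint : ∀ j ∈ Icc 1 m, IntervalIntegrable
      (fun t : ℝ => ((1 / 2 - Int.fract (c - s j + t) : ℝ) : ℂ) *
        Complex.exp (2 * Real.pi * Complex.I * d * t))
      MeasureTheory.volume (-(1 / 2)) (1 / 2) := fun j _ => by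
    have hG := intervalIntegrable_sawtooth (c - s j) (-(1 / 2)) (1 / 2)
    exact IntervalIntegrable.mul_continuousOn
      (f := fun t : ℝ => ((1 / 2 - Int.fract (c - s j + t) : ℝ) : ℂ))
      (by exact ⟨hG.1.ofReal, hG.2.ofReal⟩) (Continuous.continuousOn (by fun_prop))
  have hfun : ∀ t : ℝ, (empiricalSawtooth s m (c + t) : ℂ) *
        Complex.exp (2 * Real.pi * Complex.I * d * t) =
      (∑ j ∈ Icc 1 m, ((1 / 2 - Int.fract (c - s j + t) : ℝ) : ℂ) *
        Complex.exp (2 * Real.pi * Complex.I * d * t)) / m := by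
    intro t
    rw [empiricalSawtooth, Complex.ofReal_div, Complex.ofReal_sum, ← sum_mul, Complex.ofReal_natCast,
      div_mul_eq_mul_div]
    simp_rw [sub_add_eq_add_sub]
  have hsplit : ∀ j, Complex.exp (-(2 * Real.pi * Complex.I * d * ((c - s j : ℝ) : ℂ))) =
      Complex.exp ((-(2 * Real.pi * d * c) : ℝ) * Complex.I) *
        Complex.exp (2 * Real.pi * Complex.I * d * s j) := by
    intro j
    rw [← Complex.exp_add]
    congr 1
    push_cast
    ring
  simp_rw [hfun]
  rw [intervalIntegral.integral_div, intervalIntegral.integral_finsetSum hint]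
  simp_rw [integral_shift_sawtooth_mul_exp, hsplit]
  rw [← mul_sum, ← mul_sum, norm_div, norm_mul, norm_mul, Complex.norm_exp_ofReal_mul_I, one_mul,
    norm_sum_exp_natAbs, Complex.norm_natCast, div_eq_inv_mul, one_div, norm_neg, norm_inv]
  gcongr
  rcases eq_or_ne d 0 with rfl | h
  · simp
  · have hd : ‖(d : ℂ)‖ = d.natAbs := by
      rw [Complex.norm_intCast, Nat.cast_natAbs, Int.cast_abs]
    rw [norm_mul, hd, one_div]
    have hpos : (0 : ℝ) < d.natAbs := by exact_mod_cast Int.natAbs_pos.2 h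
    gcongr
    have hn : ‖(2 * Real.pi * Complex.I : ℂ)‖ = 2 * Real.pi := by
      simp [abs_of_pos Real.pi_pos]
    rw [hn]
    nlinarith [Real.pi_gt_three]

/-- The uniform bound for the empirical sawtooth. -/
theorem abs_empiricalSawtooth_le_sum (s : ℕ → ℝ) (m n : ℕ) (hm : 1 ≤ m) (hn : 1 ≤ n) (x : ℝ) :
    |empiricalSawtooth s m x| ≤ 40 * (1 / n + (1 / m) * ∑ k ∈ Icc 1 n, (1 / (k : ℝ)) *
      ‖∑ j ∈ Icc 1 m, Complex.exp (2 * Real.pi * Complex.I * (k : ℂ) * (s j : ℂ))‖) := by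
  set g := empiricalSawtooth s m with hg
  set S : ℕ → ℝ := fun k => (1 / (k : ℝ)) *
      ‖∑ j ∈ Icc 1 m, Complex.exp (2 * Real.pi * Complex.I * (k : ℂ) * (s j : ℂ))‖ with hS
  have hS0 : ∀ k, 0 ≤ S k := fun k => by simp only [hS]; positivity
  have hbdd : BddAbove (Set.range fun x => |g x|) :=
    ⟨1, by rintro _ ⟨x, rfl⟩; exact abs_empiricalSawtooth_le s m hm x⟩
  set M := ⨆ x, |g x| with hMdef
  have hle : ∀ y, |g y| ≤ M := fun y => le_ciSup hbdd y
  refine (hle x).trans ?_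
  have hn' : (0 : ℝ) < n := by exact_mod_cast hn
  have hsum : 0 ≤ ∑ k ∈ Icc 1 n, S k := sum_nonneg fun k _ => hS0 k
  rcases (((abs_nonneg _).trans (hle x)) : 0 ≤ M).eq_or_lt with h0 | hM
  · rw [← h0]; positivity
  have hcoef : ∀ c, |∫ t in (-(1 / 2) : ℝ)..(1 / 2), g (c + t) * fejerKernel n t| ≤
      2 * (1 / m * ∑ k ∈ Icc 1 n, S k) := by
    intro c
    refine (abs_integral_mul_fejerKernel_le n hn _
      (intervalIntegrable_empiricalSawtooth s m c _ _) (fun d => 1 / m * S d)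
      (norm_integral_empiricalSawtooth_mul_exp_le s m c)).trans ?_
    rw [← mul_sum]
    gcongr 2 * (1 / m * ?_)
    have h1 : ∑ d ∈ range n, S d = ∑ d ∈ (range n).erase 0, S d :=
      (sum_erase _ (by simp [hS])).symm
    rw [h1]
    refine sum_le_sum_of_subset_of_nonneg (fun d hd => ?_) fun d _ _ => hS0 d
    simp only [mem_erase, mem_range, mem_Icc] at hd ⊢
    omega
  have hfin : M / 4 - 5 / 2 * Real.pi / n ≤ 2 * (1 / m * ∑ k ∈ Icc 1 n, S k) := by
    obtain ⟨y, hy⟩ := exists_lt_of_lt_ciSup (show 3 / 4 * M < ⨆ x, |g x| by rw [← hMdef]; linarith)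
    rcases lt_abs.1 hy with hy | hy
    · have h := le_integral_mul_fejerKernel n hn (fun t => g (y + M / 4 + t)) M hM
        (intervalIntegrable_empiricalSawtooth s m _ _ _)
        (fun t => (abs_le.1 (hle _)).1) (fun t ht => by
          have ht' := abs_le.1 ht
          have := empiricalSawtooth_sub_le s m hm y (M / 4 + t) (by linarith)
          rw [← hg, ← add_assoc] at this
          linarith)
      exact h.trans ((le_abs_self _).trans (hcoef _))
    · have h := le_integral_mul_fejerKernel n hn (fun t => -g (y - M / 4 + t)) M hM
        (intervalIntegrable_empiricalSawtooth s m _ _ _).neg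
        (fun t => neg_le_neg (abs_le.1 (hle _)).2) (fun t ht => by
          have ht' := abs_le.1 ht
          have := empiricalSawtooth_sub_le s m hm (y - M / 4 + t) (M / 4 - t) (by linarith)
          rw [← hg, show y - M / 4 + t + (M / 4 - t) = y by ring] at this
          linarith)
      simp_rw [neg_mul] at h
      rw [intervalIntegral.integral_neg] at h
      exact h.trans ((neg_le_abs _).trans (hcoef _))
  have hpi : 5 / 2 * Real.pi / n ≤ 10 * (1 / n) := by
    rw [mul_one_div]
    gcongr
    linarith [Real.pi_le_four]
  have : 0 ≤ 1 / m * ∑ k ∈ Icc 1 n, S k := by positivity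
  linarith

theorem fract_eq_of_add_one {z : ℝ} (h1 : -1 ≤ z) (h2 : z < 0) : Int.fract z = z + 1 := by
  rw [← Int.fract_add_one, Int.fract_eq_self]
  constructor <;> linarith

/-- Up to its length, the indicator function of an interval modulo one is a difference of two
sawtooth functions. -/
theorem exists_ite_eq_sawtooth {a b : ℝ} (ha : 0 ≤ a) (hab : a ≤ b) (hb : b ≤ 1) :
    (∀ y : ℝ, (if a ≤ Int.fract y ∧ Int.fract y ≤ b then (1 : ℝ) else 0) =
      (b - a) + (1 / 2 - Int.fract (b - y)) + (1 / 2 - Int.fract (-a - -y))) ∨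
    (∀ y : ℝ, (if a ≤ Int.fract y ∧ Int.fract y ≤ b then (1 : ℝ) else 0) =
      (b - a) - (1 / 2 - Int.fract (-0 - -y)) + (1 / 2 - Int.fract (-a - -y))) := by
  have hfa : ∀ y, Int.fract (-a - -y) =
      if a ≤ Int.fract y then Int.fract y - a else Int.fract y - a + 1 := by
    intro y
    have h0 := Int.fract_nonneg y
    have h1 := Int.fract_lt_one y
    rw [show -a - -y = Int.fract y - a + (⌊y⌋ : ℤ) by unfold Int.fract; ring,
      Int.fract_add_intCast]
    split_ifs with h
    · exact Int.fract_eq_self.2 ⟨by linarith, by linarith⟩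
    · exact fract_eq_of_add_one (by linarith) (by linarith)
  rcases hb.lt_or_eq with hb | rfl
  · left
    intro y
    have h0 := Int.fract_nonneg y
    have h1 := Int.fract_lt_one y
    have hfb : Int.fract (b - y) =
        if Int.fract y ≤ b then b - Int.fract y else b - Int.fract y + 1 := by
      rw [show b - y = b - Int.fract y - (⌊y⌋ : ℤ) by unfold Int.fract; ring,
        Int.fract_sub_intCast]
      split_ifs with h
      · exact Int.fract_eq_self.2 ⟨by linarith, by linarith⟩
      · exact fract_eq_of_add_one (by linarith) (by linarith)
    rw [hfa, hfb]
    split_ifs <;> grind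
  · right
    intro y
    have h1 := Int.fract_lt_one y
    rw [hfa, show -0 - -y = y by ring]
    split_ifs <;> grind

/-- **The Erdős–Turán inequality.** There is an absolute constant `C > 0` such
that for every sequence `(s j)` of reals and all `m n ≥ 1`, the discrepancy
`D(m) = sup_{0 ≤ a ≤ b ≤ 1} |(1/m)·#{1 ≤ j ≤ m : a ≤ s_j mod 1 ≤ b} − (b−a)|`
is bounded by `C · (1/n + (1/m) ∑_{k=1}^n (1/k) |∑_{j=1}^m e^{2πi k s_j}|)`.
(The supremum bound is expressed by bounding the term for every interval
`[a,b] ⊆ [0,1]`.) -/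
theorem erdos_turan_inequality :
    ∃ C : ℝ, 0 < C ∧
      ∀ (s : ℕ → ℝ) (m n : ℕ), 1 ≤ m → 1 ≤ n →
        ∀ a b : ℝ, 0 ≤ a → a ≤ b → b ≤ 1 →
          |(((Finset.Icc 1 m).filter
                (fun j => a ≤ Int.fract (s j) ∧ Int.fract (s j) ≤ b)).card : ℝ) / m
              - (b - a)|
            ≤ C * (1 / n + (1 / m) * ∑ k ∈ Finset.Icc 1 n, (1 / (k : ℝ)) *
                ‖∑ j ∈ Finset.Icc 1 m,
                    Complex.exp (2 * Real.pi * Complex.I * (k : ℂ) * (s j : ℂ))‖) := by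
  refine ⟨80, by norm_num, fun s m n hm hn a b ha hab hb => ?_⟩
  have hm' : (m : ℝ) ≠ 0 := by simp; omega
  set R := 1 / (n : ℝ) + (1 / m) * ∑ k ∈ Finset.Icc 1 n, (1 / (k : ℝ)) *
    ‖∑ j ∈ Finset.Icc 1 m,
      Complex.exp (2 * Real.pi * Complex.I * (k : ℂ) * (s j : ℂ))‖ with hR
  have hpos : ∀ x, |empiricalSawtooth s m x| ≤ 40 * R := abs_empiricalSawtooth_le_sum s m n hm hn
  have hneg : ∀ x, |empiricalSawtooth (fun j => -s j) m x| ≤ 40 * R := by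
    intro x
    refine (abs_empiricalSawtooth_le_sum _ m n hm hn x).trans_eq ?_
    rw [hR]
    congr 3
    refine sum_congr rfl fun k _ => ?_
    congr 1
    have := norm_sum_exp_natAbs s m (-k)
    rw [Int.natAbs_neg, Int.natAbs_natCast] at this
    rw [← this]
    congr 1
    refine sum_congr rfl fun j _ => ?_
    congr 1
    push_cast
    ring
  rw [card_filter, Nat.cast_sum]
  simp_rw [Nat.cast_ite, Nat.cast_one, Nat.cast_zero]
  rcases exists_ite_eq_sawtooth ha hab hb with h | h
  · have : (∑ j ∈ Icc 1 m, if a ≤ Int.fract (s j) ∧ Int.fract (s j) ≤ b then (1 : ℝ) else 0) / m -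
        (b - a) = empiricalSawtooth s m b + empiricalSawtooth (fun j => -s j) m (-a) := by
      simp_rw [h, sum_add_distrib, empiricalSawtooth]
      simp only [sum_const, Nat.card_Icc, add_tsub_cancel_right, nsmul_eq_mul]
      field_simp
      ring
    rw [this]
    linarith [abs_add_le (empiricalSawtooth s m b) (empiricalSawtooth (fun j => -s j) m (-a)),
      hpos b, hneg (-a)]
  · have : (∑ j ∈ Icc 1 m, if a ≤ Int.fract (s j) ∧ Int.fract (s j) ≤ b then (1 : ℝ) else 0) / m -
        (b - a) = empiricalSawtooth (fun j => -s j) m (-a) -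
          empiricalSawtooth (fun j => -s j) m (-0) := by
      simp_rw [h, sum_add_distrib, sum_sub_distrib (fun _ => b - a), empiricalSawtooth]
      simp only [sum_const, Nat.card_Icc, add_tsub_cancel_right, nsmul_eq_mul]
      field_simp
      ring
    rw [this]
    linarith [abs_sub (empiricalSawtooth (fun j => -s j) m (-a))
      (empiricalSawtooth (fun j => -s j) m (-0)), hneg (-0), hneg (-a)]
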